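/- arXiv:2010.12229 — 8 statements merged into one kernel-verified Lean document; each statement's English description precedes it below -/
import Mathlib

section
/- Let G = (V, E) be a finite connected undirected graph with at least two vertices, and for each edge {i,j} ∈ E let d(i,j) ≥ 0 and d(j,i) ≥ 0 be fixed directed delays that do not depend on the chosen subgraph (edge-capacitated setting). Then there exists a spanning tree T of G such that the cycle time of the bidirected overlay on T is less than or equal to the cycle time of the bidirected overlay on every connected spanning subgraph of G. -/
/-- The list of cyclically-consecutive ordered pairs of a list
`[i₁, …, iₚ]`, namely `[(i₁,i₂), (i₂,i₃), …, (iₚ,i₁)]`. -/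
def cyclicPairs {V : Type*} (l : List V) : List (V × V) := l.zip (l.rotate 1)

/-- `c` is an elementary circuit of the digraph with arc relation `A`:
a list of at least two pairwise-distinct vertices whose cyclically
consecutive pairs are all arcs of `A`. -/
def IsElemCircuit {V : Type*} (A : V → V → Prop) (c : List V) : Prop :=
  2 ≤ c.length ∧ c.Nodup ∧ ∀ p ∈ cyclicPairs c, A p.1 p.2

/-- The total delay `d(γ)` of a circuit, i.e. the sum of the delays of its arcs. -/
def circuitDelay {V : Type*} (d : V → V → ℝ) (c : List V) : ℝ :=
  ((cyclicPairs c).map fun p => d p.1 p.2).sum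

/-- The cycle time of a digraph: the maximum over elementary circuits γ of d(γ)/|γ|. -/
noncomputable def cycleTime {V : Type*} (A : V → V → Prop) (d : V → V → ℝ) : ℝ :=
  sSup {x : ℝ | ∃ c : List V, IsElemCircuit A c ∧ x = circuitDelay d c / (c.length : ℝ)}

/-- A digraph is strongly connected if every vertex can reach every other vertex. -/
def StronglyConnected {V : Type*} (A : V → V → Prop) : Prop :=
  ∀ i j : V, Relation.ReflTransGen A i j

/-- A digraph on a finite vertex set has only finitely many circuit means. -/
lemma finite_circuitMeans {V : Type*} [Finite V] (A : V → V → Prop) (d : V → V → ℝ) :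
    {x : ℝ | ∃ c : List V, IsElemCircuit A c ∧ x = circuitDelay d c / (c.length : ℝ)}.Finite := by
  have := Fintype.ofFinite V
  refine ((List.finite_length_le V (Fintype.card V)).image
    fun c => circuitDelay d c / (c.length : ℝ)).subset ?_
  rintro x ⟨c, hc, rfl⟩
  exact ⟨c, hc.2.1.length_le_card, rfl⟩

/-- An edge of a graph, traversed back and forth, is an elementary circuit. -/
lemma SimpleGraph.Adj.isElemCircuit {V : Type*} {G : SimpleGraph V} {u v : V} (h : G.Adj u v) :
    IsElemCircuit G.Adj [u, v] := by
  simp [IsElemCircuit, cyclicPairs, h.ne, h, h.symm]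

lemma IsElemCircuit.mono {V : Type*} {A B : V → V → Prop} (hAB : ∀ i j, A i j → B i j)
    {c : List V} (hc : IsElemCircuit A c) : IsElemCircuit B c :=
  ⟨hc.1, hc.2.1, fun p hp => hAB _ _ (hc.2.2 p hp)⟩

/-- The cycle time of bidirected overlays is monotone in the graph, as soon as the smaller
graph has an edge. -/
lemma cycleTime_mono {V : Type*} [Finite V] {T H : SimpleGraph V} (hTH : T ≤ H)
    {u v : V} (huv : T.Adj u v) (d : V → V → ℝ) :
    cycleTime T.Adj d ≤ cycleTime H.Adj d := by
  refine csSup_le_csSup (finite_circuitMeans H.Adj d).bddAbove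
    ⟨_, _, huv.isElemCircuit, rfl⟩ ?_
  rintro x ⟨c, hc, rfl⟩
  exact ⟨c, hc.mono fun _ _ h => hTH h, rfl⟩

/-- In the edge-capacitated setting (directed delays on the edges of a
finite connected undirected graph `G` that do not depend on the chosen subgraph), there
is a spanning tree of `G` whose bidirected overlay has cycle time at most that of the
bidirected overlay on any connected spanning subgraph of `G`. -/
theorem exists_spanning_tree_minimal_cycleTime {V : Type*} [Fintype V]
    (G : SimpleGraph V) (hG : G.Connected) (hcard : 2 ≤ Fintype.card V)
    (d : V → V → ℝ)
    (hnonneg : ∀ i j, G.Adj i j → 0 ≤ d i j) :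
    ∃ T : SimpleGraph V, T ≤ G ∧ T.IsTree ∧
      ∀ H : SimpleGraph V, H ≤ G → H.Connected →
        cycleTime T.Adj d ≤ cycleTime H.Adj d := by
  have : Nontrivial V := Fintype.one_lt_card_iff_nontrivial.mp hcard
  obtain ⟨T₀, hT₀G, hT₀⟩ := hG.exists_isTree_le
  obtain ⟨T, ⟨hTG, hT⟩, hmin⟩ := Set.exists_min_image {T : SimpleGraph V | T ≤ G ∧ T.IsTree}
    (fun T => cycleTime T.Adj d) (Set.toFinite _) ⟨T₀, hT₀G, hT₀⟩
  refine ⟨T, hTG, hT, fun H hHG hH => ?_⟩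
  obtain ⟨S, hSH, hS⟩ := hH.exists_isTree_le
  obtain ⟨u⟩ := hS.1.nonempty
  obtain ⟨v, huv⟩ := hS.1.preconnected.exists_adj_of_nontrivial u
  exact (hmin S ⟨hSH.trans hHG, hS⟩).trans (cycleTime_mono hSH huv d)
end

section
/- Let G = (V, E) be a finite connected undirected graph with at least two vertices, and for each edge {i,j} ∈ E let d(i,j) ≥ 0 and d(j,i) ≥ 0 be fixed directed delays that do not depend on the chosen subgraph (edge-capacitated setting); define the symmetrized weight w({i,j}) = (d(i,j) + d(j,i))/2. Then every minimum weight spanning tree of G with respect to w attains the minimum cycle time among connected spanning subgraphs: if T is an MST of (G, w), then for every connected spanning subgraph H of G, the cycle time of the bidirected overlay on T is less than or equal to the cycle time of the bidirected overlay on H. -/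
open SimpleGraph

/-- The delay-to-length ratios of the elementary circuits of a finite digraph are bounded. -/
lemma bddAbove_circuit_ratios {V : Type*} [Fintype V] (A : V → V → Prop) (d : V → V → ℝ) :
    BddAbove {x : ℝ | ∃ c : List V, IsElemCircuit A c ∧
      x = circuitDelay d c / (c.length : ℝ)} := by
  refine (((List.finite_length_le V (Fintype.card V)).image
    fun c => circuitDelay d c / (c.length : ℝ)).subset ?_).bddAbove
  rintro x ⟨c, hc, rfl⟩
  exact ⟨c, hc.2.1.length_le_card, rfl⟩

lemma isElemCircuit_pair {V : Type*} (G : SimpleGraph V) {a b : V} (h : G.Adj a b) :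
    IsElemCircuit G.Adj [a, b] := by
  simp [IsElemCircuit, cyclicPairs, h, h.symm, h.ne]

lemma circuitDelay_pair_div {V : Type*} (d : V → V → ℝ) (a b : V) :
    circuitDelay d [a, b] / (([a, b] : List V).length : ℝ) = (d a b + d b a) / 2 := by
  simp [circuitDelay, cyclicPairs]

lemma reflTransGen_of_zip {V : Type*} {A : V → V → Prop} {a : V} (l : List V) (x : V)
    (h : ∀ p ∈ (x :: l).zip (l ++ [a]), A p.1 p.2) : Relation.ReflTransGen A x a := by
  induction l generalizing x with
  | nil => exact .single (h (x, a) (by simp))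
  | cons y l ih =>
    exact .head (h (x, y) (by simp)) (ih y fun p hp => h p (by simp_all))

/-- The only elementary circuits of a bidirected forest are its edges traversed back and forth. -/
lemma SimpleGraph.IsAcyclic.exists_eq_pair_of_isElemCircuit {V : Type*} {T : SimpleGraph V}
    (hT : T.IsAcyclic) {c : List V} (hc : IsElemCircuit T.Adj c) :
    ∃ a b, T.Adj a b ∧ c = [a, b] := by
  obtain ⟨hlen, hnd, harc⟩ := hc
  match c, hlen with
  | [a, b], _ => exact ⟨a, b, harc (a, b) (by simp [cyclicPairs]), rfl⟩
  | a :: b :: x :: l, _ =>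
    exfalso
    have hab : T.Adj a b := harc (a, b) (by simp [cyclicPairs])
    refine isBridge_iff.1 (isAcyclic_iff_forall_adj_isBridge.1 hT hab) (Reachable.symm ?_)
    rw [reachable_iff_reflTransGen]
    refine reflTransGen_of_zip (x :: l) b fun p hp => ?_
    have hadj : T.Adj p.1 p.2 := harc p (by simp_all [cyclicPairs])
    have hmem : p.1 ∈ b :: x :: l := (List.of_mem_zip hp).1
    have hpa : p.1 ≠ a := by
      rintro h
      rw [h] at hmem
      exact (List.nodup_cons.1 hnd).1 hmem
    refine (deleteEdges_adj ..).2 ⟨hadj, fun he => ?_⟩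
    have hpb : p.1 = b ∧ p.2 = a := by
      have := Sym2.eq_iff.1 (Set.mem_singleton_iff.1 he)
      tauto
    rw [List.cons_append, List.zip_cons_cons, List.mem_cons] at hp
    rcases hp with rfl | hp
    · simp_all
    · have := (List.of_mem_zip hp).1
      simp_all

/-- Deleting the edge `uv` from a connected graph leaves at most the two components
of `u` and `v`. -/
lemma SimpleGraph.Connected.reachable_deleteEdges_or {V : Type*} {T : SimpleGraph V}
    (hT : T.Connected) (u v w : V) :
    (T.deleteEdges {s(u, v)}).Reachable u w ∨ (T.deleteEdges {s(u, v)}).Reachable v w := by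
  have h := (reachable_iff_reflTransGen u w).1 (hT u w)
  induction h with
  | refl => exact .inl .rfl
  | @tail x y _ hxy ih =>
    by_cases he : s(x, y) = s(u, v)
    · rcases Sym2.eq_iff.1 he with ⟨_, rfl⟩ | ⟨_, rfl⟩
      · exact .inr .rfl
      · exact .inl .rfl
    · have hadj : (T.deleteEdges {s(u, v)}).Adj x y := (deleteEdges_adj ..).2 ⟨hxy, he⟩
      exact ih.imp (·.trans hadj.reachable) (·.trans hadj.reachable)

/-- Exchange property: replacing an edge `uv` of a tree by an edge `ab` across the cut it
defines gives a tree. -/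
lemma SimpleGraph.IsTree.exchange {V : Type*} {T : SimpleGraph V} (hT : T.IsTree) {u v a b : V}
    (ha : (T.deleteEdges {s(u, v)}).Reachable u a)
    (hb : ¬ (T.deleteEdges {s(u, v)}).Reachable u b) :
    (T.deleteEdges {s(u, v)} ⊔ edge a b).IsTree := by
  have hle : T.deleteEdges {s(u, v)} ≤ T.deleteEdges {s(u, v)} ⊔ edge a b := le_sup_left
  have hne : a ≠ b := fun h => hb (h ▸ ha)
  have hvb := (hT.connected.reachable_deleteEdges_or u v b).resolve_left hb
  have hab : (T.deleteEdges {s(u, v)} ⊔ edge a b).Adj a b := by simp [edge_adj, hne]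
  have huv := ((ha.mono hle).trans hab.reachable).trans (hvb.mono hle).symm
  refine ⟨(connected_iff_exists_forall_reachable _).2 ⟨u, fun w => ?_⟩, ?_⟩
  · rcases hT.connected.reachable_deleteEdges_or u v w with h | h
    · exact h.mono hle
    · exact huv.trans (h.mono hle)
  · exact (hT.isAcyclic.anti (deleteEdges_le _)).sup_edge_of_not_reachable
      fun h => hb (ha.trans h)

/-- For a minimum weight spanning tree `T` of `G`, every edge `uv` of `T` weighs at most as much as
every edge `ab` of `G` across the cut that it defines. -/
lemma SimpleGraph.IsTree.weight_le_of_minimal {V : Type*} [Finite V] {G T : SimpleGraph V}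
    (w : Sym2 V → ℝ) (hTG : T ≤ G) (hT : T.IsTree)
    (hMST : ∀ T' : SimpleGraph V, T' ≤ G → T'.IsTree →
      ∑ᶠ e ∈ T.edgeSet, w e ≤ ∑ᶠ e ∈ T'.edgeSet, w e)
    {u v a b : V} (huv : T.Adj u v) (hab : G.Adj a b)
    (ha : (T.deleteEdges {s(u, v)}).Reachable u a)
    (hb : ¬ (T.deleteEdges {s(u, v)}).Reachable u b) :
    w s(u, v) ≤ w s(a, b) := by
  have hle : T.deleteEdges {s(u, v)} ⊔ edge a b ≤ G :=
    sup_le ((deleteEdges_le _).trans hTG) ((edge_le_iff _).2 (.inr hab))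
  have hsum := hMST _ hle (hT.exchange ha hb)
  have hT_sum := finsum_mem_add_sdiff (f := w)
    (Set.singleton_subset_iff.2 ((mem_edgeSet _).2 huv)) (Set.toFinite T.edgeSet)
  have hT'_eq : (T.deleteEdges {s(u, v)} ⊔ edge a b).edgeSet =
      insert s(a, b) (T.edgeSet \ {s(u, v)}) := by
    rw [edgeSet_sup, edgeSet_deleteEdges, edgeSet_edge_of_ne hab.ne, Set.union_singleton]
  have hnot : s(a, b) ∉ T.edgeSet \ {s(u, v)} := by
    rw [← edgeSet_deleteEdges, mem_edgeSet]
    exact fun h => hb (ha.trans h.reachable)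
  rw [finsum_mem_singleton] at hT_sum
  rw [hT'_eq, finsum_mem_insert _ hnot (Set.toFinite _), ← hT_sum] at hsum
  linarith

/-- **Prop. 1.** In the edge-capacitated setting, every minimum weight
spanning tree of `G` with respect to the symmetrized weights
`w({i,j}) = (d(i,j)+d(j,i))/2` attains the minimum cycle time among connected
spanning subgraphs of `G`. -/
theorem mst_minimizes_cycleTime {V : Type*} [Fintype V]
    (G : SimpleGraph V) (hG : G.Connected) (hcard : 2 ≤ Fintype.card V)
    (d : V → V → ℝ)
    (hnonneg : ∀ i j, G.Adj i j → 0 ≤ d i j)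
    (T : SimpleGraph V) (hTG : T ≤ G) (hT : T.IsTree)
    (hMST : ∀ T' : SimpleGraph V, T' ≤ G → T'.IsTree →
      (∑ᶠ e ∈ T.edgeSet,
          Sym2.lift ⟨fun i j => (d i j + d j i) / 2, fun i j => by ring⟩ e) ≤
      ∑ᶠ e ∈ T'.edgeSet,
          Sym2.lift ⟨fun i j => (d i j + d j i) / 2, fun i j => by ring⟩ e) :
    ∀ H : SimpleGraph V, H ≤ G → H.Connected →
      cycleTime T.Adj d ≤ cycleTime H.Adj d := by
  intro H hHG hH
  have : Nontrivial V := Fintype.one_lt_card_iff_nontrivial.1 hcard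
  apply csSup_le
  · obtain ⟨b, hb⟩ := hT.connected.preconnected.exists_adj_of_nontrivial (Classical.arbitrary V)
    exact ⟨_, _, isElemCircuit_pair T hb, rfl⟩
  · rintro x ⟨c, hc, rfl⟩
    obtain ⟨u, v, huv, rfl⟩ := hT.isAcyclic.exists_eq_pair_of_isElemCircuit hc
    have hcut := isBridge_iff.1 (isAcyclic_iff_forall_adj_isBridge.1 hT.isAcyclic huv)
    obtain ⟨p⟩ := hH u v
    obtain ⟨⟨⟨a, b⟩, hab⟩, -, ha, hb⟩ :=
      p.exists_boundary_dart {y | (T.deleteEdges {s(u, v)}).Reachable u y} Reachable.rfl hcut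
    have hle := hT.weight_le_of_minimal _ hTG hMST huv (hHG hab) ha hb
    rw [circuitDelay_pair_div]
    refine le_trans hle (le_csSup (bddAbove_circuit_ratios H.Adj d)
      ⟨[a, b], isElemCircuit_pair H hab, ?_⟩)
    rw [circuitDelay_pair_div]
    rfl
end

section
/- Let V be a finite set of N ≥ 2 vertices and let d be a Euclidean delay function on V (symmetric and satisfying the triangle inequality, with nonnegative values). Let τ* be the minimum, over all strongly connected spanning subdigraphs G of the complete digraph on V, of the cycle time τ(G). Then every Hamiltonian cycle H* of the complete digraph that minimizes the total delay (an optimal tour) satisfies d(H*)/N ≤ 2N·τ*, where d(H*) is the sum of the delays of the N arcs of H*. -/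
/-- A Hamiltonian cycle of the complete digraph on a finite vertex type:
a list of pairwise-distinct vertices containing every vertex. -/
def IsHamCycle {V : Type*} (c : List V) : Prop := c.Nodup ∧ ∀ v : V, v ∈ c

theorem circuitDelay_cons {V : Type*} (d : V → V → ℝ) (i : V) (l : List V) :
    circuitDelay d (i :: l) =
      (((i :: l).zip (l ++ [i])).map fun p => d p.1 p.2).sum := by
  simp [circuitDelay, cyclicPairs]

theorem circuitDelay_rotate {V : Type*} (d : V → V → ℝ) (l : List V) (n : ℕ) :
    circuitDelay d (l.rotate n) = circuitDelay d l := by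
  have h : cyclicPairs (l.rotate n) = (cyclicPairs l).rotate n := by
    unfold cyclicPairs
    rw [List.rotate_rotate, Nat.add_comm, ← List.rotate_rotate]
    simp only [List.zip]
    rw [List.zipWith_rotate_distrib _ _ _ _ (by simp)]
  unfold circuitDelay
  rw [h, List.map_rotate]
  exact (List.rotate_perm _ _).sum_eq

/-- Inserting a new vertex `j` after the first vertex `i` of a tour costs at most `2 * d i j`. -/
theorem circuitDelay_insert_le {V : Type*} (d : V → V → ℝ)
    (hsymm : ∀ i j : V, d i j = d j i)
    (htri : ∀ i j k : V, i ≠ j → i ≠ k → j ≠ k → d i j ≤ d i k + d k j)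
    {i j k : V} {l : List V} (hik : i ≠ k) (hij : i ≠ j) (hjk : j ≠ k) :
    circuitDelay d (i :: j :: k :: l) ≤ circuitDelay d (i :: k :: l) + 2 * d i j := by
  simp only [circuitDelay_cons, List.cons_append, List.zip_cons_cons, List.map_cons,
    List.sum_cons]
  have := htri j k i hjk hij.symm hik.symm
  rw [hsymm j i] at this
  linarith

/-- A strongly connected digraph has an arc leaving every nonempty proper vertex set. -/
theorem StronglyConnected.exists_arc_leaving {V : Type*} {A : V → V → Prop}
    (hA : StronglyConnected A) {S : Set V} {a b : V} (ha : a ∈ S) (hb : b ∉ S) :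
    ∃ i ∈ S, ∃ j ∉ S, A i j := by
  by_contra! h
  have hclosed : ∀ x, Relation.ReflTransGen A a x → x ∈ S := by
    intro x hx
    induction hx with
    | refl => exact ha
    | tail _ hxy ih => exact by_contra fun hy => h _ ih _ hy hxy
  exact hb (hclosed b (hA a b))

/-- If all arcs of a strongly connected digraph have delay at most `M`, then vertices can be
inserted one at a time to form a tour on `n + 2` vertices of delay at most `2 * (n + 1) * M`. -/
theorem exists_nodup_circuitDelay_le {V : Type*} [Fintype V] (d : V → V → ℝ)
    (hsymm : ∀ i j : V, d i j = d j i)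
    (htri : ∀ i j k : V, i ≠ j → i ≠ k → j ≠ k → d i j ≤ d i k + d k j)
    {A : V → V → Prop} (hA : StronglyConnected A) {M : ℝ}
    (hM : ∀ i j, A i j → d i j ≤ M) (n : ℕ) (hn : n + 2 ≤ Fintype.card V) :
    ∃ c : List V, c.Nodup ∧ c.length = n + 2 ∧ circuitDelay d c ≤ 2 * (n + 1) * M := by
  classical
  induction n with
  | zero =>
    obtain ⟨a, b, hab⟩ := Fintype.exists_pair_of_one_lt_card (α := V) (by omega)
    obtain ⟨i, rfl, j, hj, hij⟩ := hA.exists_arc_leaving (S := {a}) rfl (Ne.symm hab)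
    refine ⟨[i, j], by simpa [eq_comm] using hj, rfl, ?_⟩
    have := hM _ _ hij
    simp only [circuitDelay_cons, List.cons_append, List.zip_cons_cons, List.map_cons,
      List.sum_cons, List.nil_append, List.zip_nil_left, List.map_nil, List.sum_nil, hsymm j i]
    push_cast
    linarith
  | succ n ih =>
    obtain ⟨c, hc, hlen, hle⟩ := ih (by omega)
    obtain ⟨b, hb⟩ : ∃ b, b ∉ c := by
      by_contra! h
      have h1 : c.toFinset = Finset.univ := by ext; simp [h]
      have h2 := List.toFinset_card_of_nodup hc
      rw [h1, Finset.card_univ] at h2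
      omega
    obtain ⟨a, ha⟩ := List.exists_mem_of_length_pos (l := c) (by omega)
    obtain ⟨i, hi, j, hj, hij⟩ := hA.exists_arc_leaving (S := {v | v ∈ c}) ha hb
    obtain ⟨m, l, hl⟩ : ∃ m l, c.rotate m = i :: l := by
      obtain ⟨s, t, rfl⟩ := List.append_of_mem hi
      exact ⟨s.length, t ++ s, by simp [List.rotate_append_length_eq]⟩
    have hnd : (i :: l).Nodup := hl ▸ List.nodup_rotate.2 hc
    have hll : (i :: l).length = n + 2 := by rw [← hl, List.length_rotate, hlen]
    have hjl : j ∉ i :: l := by rw [← hl, List.mem_rotate]; exact hj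
    rw [← circuitDelay_rotate d c m, hl] at hle
    cases l with
    | nil => simp at hll
    | cons k l =>
      simp only [List.nodup_cons, List.mem_cons, not_or] at hnd hjl
      refine ⟨i :: j :: k :: l, ?_, by simpa using hll, ?_⟩
      · simp only [List.nodup_cons, List.mem_cons, not_or]
        exact ⟨⟨Ne.symm hjl.1, hnd.1⟩, hjl.2, hnd.2⟩
      · have h1 := circuitDelay_insert_le d hsymm htri (l := l) hnd.1.1 (Ne.symm hjl.1) hjl.2.1
        have h2 := hM _ _ hij
        push_cast
        linarith

/-- Reachability of `i` from `k` is witnessed by an elementary path, which the arc `(i, t)`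
extends to `t`. -/
theorem exists_nodup_path {V : Type*} {A : V → V → Prop} {i t : V} (hit : A i t) {k : V}
    (h : Relation.ReflTransGen A k i) :
    ∃ l : List V, (k :: l).Nodup ∧ (∀ p ∈ (k :: l).zip (l ++ [t]), A p.1 p.2) ∧
      ∃ s, k :: l = s ++ [i] := by
  induction h using Relation.ReflTransGen.head_induction_on with
  | refl => exact ⟨[], by simp, by simpa using hit, [], rfl⟩
  | @head k m hkm _ ih =>
    obtain ⟨l, hnd, harc, s, hs⟩ := ih
    by_cases hk : k ∈ m :: l
    · rcases List.mem_cons.1 hk with rfl | hk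
      · exact ⟨l, hnd, harc, s, hs⟩
      · obtain ⟨a, b, rfl⟩ := List.append_of_mem hk
        refine ⟨b, hnd.of_cons.of_append_right, fun p hp => harc p ?_, ?_⟩
        · have : (m :: (a ++ k :: b)).zip ((a ++ k :: b) ++ [t]) =
              (m :: a).zip (a ++ [k]) ++ (k :: b).zip (b ++ [t]) := by
            rw [← List.zip_append (by simp)]
            simp
          rw [this]
          exact List.mem_append_right _ hp
        · rcases List.eq_nil_or_concat (k :: b) with h | ⟨s', x, h⟩
          · simp at h
          · rw [List.concat_eq_append] at h
            refine ⟨s', ?_⟩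
            rw [h, ← List.cons_append, ← List.append_assoc] at hs
            rw [h, (List.append_inj' hs rfl).2]
    · refine ⟨m :: l, List.nodup_cons.2 ⟨hk, hnd⟩, ?_, k :: s, by simp [hs]⟩
      simp only [List.cons_append, List.zip_cons_cons, List.mem_cons, forall_eq_or_imp]
      exact ⟨hkm, by simpa using harc⟩

/-- Every arc of a strongly connected loopless digraph lies on an elementary circuit. -/
theorem StronglyConnected.exists_elemCircuit {V : Type*} {A : V → V → Prop}
    (hirr : ∀ i j, A i j → i ≠ j) (hA : StronglyConnected A) {i j : V} (hij : A i j) :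
    ∃ c, IsElemCircuit A c ∧ (i, j) ∈ cyclicPairs c := by
  obtain ⟨l, hnd, harc, s, hs⟩ := exists_nodup_path hij (hA j i)
  have hc : cyclicPairs (j :: l) = (j :: l).zip (l ++ [j]) := by simp [cyclicPairs]
  refine ⟨j :: l, ⟨?_, hnd, by rwa [hc]⟩, ?_⟩
  · cases l with
    | nil =>
      have := (List.append_inj' (s₁ := []) hs rfl).2
      simp only [List.cons.injEq, and_true] at this
      exact absurd this.symm (hirr i j hij)
    | cons => simp
  · have hlen := congrArg List.length hs
    rw [hc, hs, List.zip_append (by simpa using hlen.symm)]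
    simp

theorem bddAbove_circuit_means {V : Type*} [Finite V] (A : V → V → Prop) (d : V → V → ℝ) :
    BddAbove {x : ℝ | ∃ c : List V, IsElemCircuit A c ∧
      x = circuitDelay d c / (c.length : ℝ)} := by
  have := Fintype.ofFinite V
  have hfin : {c : List V | c.length ≤ Fintype.card V}.Finite := List.finite_length_le V _
  refine ((hfin.image fun c => circuitDelay d c / (c.length : ℝ)).subset ?_).bddAbove
  rintro x ⟨c, hc, rfl⟩
  exact ⟨c, hc.2.1.length_le_card, rfl⟩

/-- Each arc delay is at most the number of vertices times the cycle time. -/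
theorem StronglyConnected.delay_le_card_mul_cycleTime {V : Type*} [Fintype V]
    {d : V → V → ℝ} (hnonneg : ∀ i j : V, i ≠ j → 0 ≤ d i j) {A : V → V → Prop}
    (hirr : ∀ i j, A i j → i ≠ j) (hA : StronglyConnected A) {i j : V} (hij : A i j) :
    d i j ≤ Fintype.card V * cycleTime A d := by
  obtain ⟨c, hc, hmem⟩ := hA.exists_elemCircuit hirr hij
  have hpos : ∀ x ∈ (cyclicPairs c).map fun p => d p.1 p.2, 0 ≤ x := by
    intro x hx
    obtain ⟨p, hp, rfl⟩ := List.mem_map.1 hx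
    exact hnonneg _ _ (hirr _ _ (hc.2.2 p hp))
  have hle : d i j ≤ circuitDelay d c :=
    List.single_le_sum hpos _ (List.mem_map.2 ⟨(i, j), hmem, rfl⟩)
  have hsup : circuitDelay d c / (c.length : ℝ) ≤ cycleTime A d :=
    le_csSup (bddAbove_circuit_means A d) ⟨c, hc, rfl⟩
  have hclen : (0 : ℝ) < c.length := by
    have := hc.1
    exact_mod_cast (by omega : 0 < c.length)
  have hcard : (c.length : ℝ) ≤ Fintype.card V := by exact_mod_cast hc.2.1.length_le_card
  have hτ : 0 ≤ cycleTime A d :=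
    (div_nonneg (List.sum_nonneg hpos) hclen.le).trans hsup
  rw [div_le_iff₀ hclen] at hsup
  nlinarith

/-- **Lemma 5.** For a Euclidean delay function on `N ≥ 2` vertices, every
optimal Hamiltonian tour `H*` of the complete digraph satisfies
`d(H*)/N ≤ 2N·τ*`, where `τ*` is the minimum cycle time over all strongly connected
spanning subdigraphs of the complete digraph. -/
theorem optimal_tour_le_two_N_mul_optimal_cycleTime {V : Type*} [Fintype V]
    (hN : 2 ≤ Fintype.card V)
    (d : V → V → ℝ)
    (hnonneg : ∀ i j : V, i ≠ j → 0 ≤ d i j)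
    (hsymm : ∀ i j : V, d i j = d j i)
    (htri : ∀ i j k : V, i ≠ j → i ≠ k → j ≠ k → d i j ≤ d i k + d k j)
    (Hstar : List V) (hHam : IsHamCycle Hstar)
    (hopt : ∀ c : List V, IsHamCycle c → circuitDelay d Hstar ≤ circuitDelay d c) :
    circuitDelay d Hstar / (Fintype.card V : ℝ) ≤
      2 * (Fintype.card V : ℝ) *
        sInf {x : ℝ | ∃ A : V → V → Prop, (∀ i j, A i j → i ≠ j) ∧
          StronglyConnected A ∧ x = cycleTime A d} := by
  classical
  have hN0 : (0 : ℝ) < Fintype.card V := by exact_mod_cast (by omega : 0 < Fintype.card V)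
  have hne : {x : ℝ | ∃ A : V → V → Prop, (∀ i j, A i j → i ≠ j) ∧
      StronglyConnected A ∧ x = cycleTime A d}.Nonempty := by
    refine ⟨_, fun i j => i ≠ j, fun _ _ h => h, fun i j => ?_, rfl⟩
    by_cases h : i = j
    · exact h ▸ .refl
    · exact .single h
  rw [← div_le_iff₀' (by positivity)]
  refine le_csInf hne ?_
  rintro x ⟨A, hirr, hA, rfl⟩
  have hM : ∀ i j, A i j → d i j ≤ Fintype.card V * cycleTime A d :=
    fun i j hij => hA.delay_le_card_mul_cycleTime hnonneg hirr hij
  obtain ⟨n, hn⟩ := Nat.exists_eq_add_of_le' hN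
  obtain ⟨c, hnd, hlen, hle⟩ := exists_nodup_circuitDelay_le d hsymm htri hA hM n hn.ge
  have hcV : ∀ v, v ∈ c := by
    have h : c.toFinset = Finset.univ := by
      rw [← Finset.card_eq_iff_eq_univ, List.toFinset_card_of_nodup hnd, hlen, hn]
    intro v
    rw [← List.mem_toFinset, h]
    exact Finset.mem_univ v
  have hτ : 0 ≤ cycleTime A d := by
    obtain ⟨a, b, hab⟩ := Fintype.exists_pair_of_one_lt_card (α := V) (by omega)
    obtain ⟨i, -, j, -, hij⟩ := hA.exists_arc_leaving (S := {a}) rfl (Ne.symm hab)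
    exact nonneg_of_mul_nonneg_right
      ((hnonneg i j (hirr i j hij)).trans (hM i j hij)) hN0
  have htour := (hopt c ⟨hnd, hcV⟩).trans hle
  have hn' : (n : ℝ) + 1 ≤ Fintype.card V := by exact_mod_cast (by omega : n + 1 ≤ Fintype.card V)
  rw [div_le_iff₀ (by positivity), div_le_iff₀ hN0]
  have := mul_le_mul_of_nonneg_right hn' (mul_nonneg hN0.le hτ)
  linarith
end

section
/- Let D = (V, E) be a connected undirected graph with N = |V| ≥ 3 vertices, fix a vertex v_0 ∈ V, and define a delay function d on ordered pairs of distinct vertices by: d(i,j) = 1 if {i,j} ∈ E and i ≠ v_0 and j ≠ v_0; d(i,j) = 2 if either ({i,j} ∈ E and (i = v_0 or j = v_0)) or ({i,j} ∉ E and i ≠ v_0 and j ≠ v_0); and d(i,j) = 3 if {i,j} ∉ E and (i = v_0 or j = v_0). Then D has a Hamiltonian cycle if and only if the complete digraph on V has a strongly connected spanning subdigraph whose cycle time with respect to d is at most (N+2)/N. -/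
theorem forall_mem_zip_concat_iff_isChain {V : Type*} (R : V → V → Prop) (x y : V) (t : List V) :
    (∀ p ∈ (x :: t).zip (t ++ [y]), R p.1 p.2) ↔ (x :: (t ++ [y])).IsChain R := by
  induction t generalizing x with
  | nil => simp
  | cons z t ih =>
    rw [List.cons_append, List.isChain_cons_cons, ← ih, List.zip_cons_cons]
    exact List.forall_mem_cons

theorem forall_mem_cyclicPairs_cons {V : Type*} (R : V → V → Prop) (x : V) (t : List V) :
    (∀ p ∈ cyclicPairs (x :: t), R p.1 p.2) ↔ (x :: (t ++ [x])).IsChain R := by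
  rw [← forall_mem_zip_concat_iff_isChain]
  simp [cyclicPairs]

/-- The successor of a vertex along a list without repetitions is unique. -/
theorem cyclicPairs_snd_unique {V : Type*} {c : List V} (hc : c.Nodup) {u v w : V}
    (hv : (u, v) ∈ cyclicPairs c) (hw : (u, w) ∈ cyclicPairs c) : v = w := by
  obtain ⟨i, hi, hvi⟩ := List.getElem_of_mem hv
  obtain ⟨j, hj, hwj⟩ := List.getElem_of_mem hw
  simp only [cyclicPairs, List.getElem_zip, Prod.mk.injEq] at hvi hwj
  have hij : i = j := (hc.getElem_inj_iff).1 (hvi.1.trans hwj.1.symm)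
  subst hij
  exact hvi.2.symm.trans hwj.2

theorem exists_mem_cyclicPairs_of_mem {V : Type*} {c : List V} {u : V} (hu : u ∈ c) :
    ∃ v ∈ c, (u, v) ∈ cyclicPairs c := by
  obtain ⟨i, hi, rfl⟩ := List.getElem_of_mem hu
  have hi' : i < (c.rotate 1).length := by simpa using hi
  refine ⟨(c.rotate 1)[i], List.mem_rotate.1 (List.getElem_mem hi'), ?_⟩
  have hz : i < (c.zip (c.rotate 1)).length := by simpa using hi
  have := List.getElem_mem hz
  rwa [List.getElem_zip] at this

/-- The arcs of a closed circuit through all vertices form a strongly connected digraph. -/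
theorem stronglyConnected_cyclicPairs {V : Type*} {c : List V} (hc : ∀ v, v ∈ c) :
    StronglyConnected fun i j => (i, j) ∈ cyclicPairs c := by
  intro i j
  cases c with
  | nil => exact absurd (hc i) List.not_mem_nil
  | cons x t =>
    set A : V → V → Prop := fun i j => (i, j) ∈ cyclicPairs (x :: t)
    have hA : (x :: (t ++ [x])).IsChain A :=
      (forall_mem_cyclicPairs_cons A x t).1 fun p hp => hp
    have hP : (x :: (t ++ [x])).Pairwise (Relation.ReflTransGen A) :=
      List.isChain_iff_pairwise.1 (hA.imp fun _ _ => Relation.ReflTransGen.single)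
    rw [List.pairwise_cons, List.pairwise_append] at hP
    have hto : Relation.ReflTransGen A i x := by
      rcases List.mem_cons.1 (hc i) with rfl | hi
      · exact .refl
      · exact hP.2.2.2 i hi x (by simp)
    have hfrom : Relation.ReflTransGen A x j := by
      rcases List.mem_cons.1 (hc j) with rfl | hj
      · exact .refl
      · exact hP.1 j (by simp [hj])
    exact hto.trans hfrom

/-- A digraph whose arcs are those of a Hamiltonian circuit has only spanning circuits. -/
theorem IsElemCircuit.mem_of_cyclicPairs {V : Type*} {c γ : List V} (hc : c.Nodup)
    (hmem : ∀ v, v ∈ c) (hγ : IsElemCircuit (fun i j => (i, j) ∈ cyclicPairs c) γ) (v : V) :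
    v ∈ γ := by
  have hpos : 0 < γ.length := by have := hγ.1; omega
  have hreach := stronglyConnected_cyclicPairs hmem γ[0] v
  induction hreach with
  | refl => exact List.getElem_mem hpos
  | tail _ hbc ih =>
    obtain ⟨w, hw, hbw⟩ := exists_mem_cyclicPairs_of_mem ih
    rwa [cyclicPairs_snd_unique hc hbc (hγ.2.2 _ hbw)]

theorem exists_nodup_isChain_of_reflTransGen {V : Type*} {A : V → V → Prop} {x y : V}
    (h : Relation.ReflTransGen A x y) :
    ∃ t : List V, (x :: t).IsChain A ∧ (x :: t).Nodup ∧
      (x :: t).getLast (List.cons_ne_nil x t) = y := by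
  induction h using Relation.ReflTransGen.head_induction_on with
  | refl => exact ⟨[], by simp⟩
  | @head a b hab _ ih =>
    obtain ⟨t, hchain, hnodup, hlast⟩ := ih
    by_cases ha : a ∈ b :: t
    · obtain ⟨s, r, hsr⟩ := List.append_of_mem ha
      have hsuf : a :: r <:+ b :: t := ⟨s, hsr.symm⟩
      refine ⟨r, hchain.suffix hsuf, hnodup.sublist hsuf.sublist, ?_⟩
      rw [← hlast]
      simp [hsr]
    · refine ⟨b :: t, List.isChain_cons_cons.2 ⟨hab, hchain⟩, List.nodup_cons.2 ⟨ha, hnodup⟩, ?_⟩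
      rw [← hlast]
      simp

theorem StronglyConnected.exists_isElemCircuit_mem {V : Type*} [Nontrivial V]
    {A : V → V → Prop} (hA : StronglyConnected A) (hirrefl : ∀ i j, A i j → i ≠ j) (v : V) :
    ∃ c, IsElemCircuit A c ∧ v ∈ c := by
  obtain ⟨w, hw⟩ := exists_ne v
  obtain h | ⟨x, hvx, -⟩ := (hA v w).cases_head
  · exact absurd h.symm hw
  obtain ⟨t, hchain, hnodup, hlast⟩ := exists_nodup_isChain_of_reflTransGen (hA x v)
  have hv : v ∈ x :: t := hlast ▸ List.getLast_mem _
  refine ⟨x :: t, ⟨?_, hnodup, ?_⟩, hv⟩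
  · have : v ∈ t := (List.mem_cons.1 hv).resolve_left (hirrefl v x hvx)
    have := List.length_pos_of_mem this
    simp only [List.length_cons]
    omega
  · rw [forall_mem_cyclicPairs_cons, ← List.cons_append, List.isChain_append]
    refine ⟨hchain, List.isChain_singleton _, ?_⟩
    intro a ha b hb
    rw [List.getLast?_eq_some_getLast (List.cons_ne_nil x t), hlast] at ha
    simp only [Option.mem_def, Option.some.injEq, List.head?_cons] at ha hb
    exact ha ▸ hb ▸ hvx

theorem sum_map_indicator_eq_one {V : Type*} [DecidableEq V] {l : List V} (hl : l.Nodup) {v : V}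
    (hv : v ∈ l) : (l.map fun i => if i = v then (1 : ℝ) else 0).sum = 1 := by
  have hcount : (l.map fun i => if i = v then (1 : ℝ) else 0).sum = l.count v := by
    clear hl hv
    induction l with
    | nil => simp
    | cons x l ih =>
      rw [List.map_cons, List.sum_cons, ih, List.count_cons]
      by_cases h : x = v <;> simp [h, add_comm]
  rw [hcount, List.count_eq_one_of_mem hl hv, Nat.cast_one]

/-- A circuit through `v` whose arcs cost one, plus one for each endpoint equal to `v`,
plus an extra `h`, has delay its length plus two plus the sum of the extras. -/
theorem circuitDelay_eq_length_add_two_add {V : Type*} [DecidableEq V] {d h : V → V → ℝ} {v : V}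
    {c : List V} (hc : c.Nodup) (hv : v ∈ c)
    (hd : ∀ p ∈ cyclicPairs c, d p.1 p.2 =
      1 + (if p.1 = v then 1 else 0) + (if p.2 = v then 1 else 0) + h p.1 p.2) :
    circuitDelay d c = c.length + 2 + circuitDelay h c := by
  have hfst : (cyclicPairs c).map Prod.fst = c := List.map_fst_zip (by simp)
  have hsnd : (cyclicPairs c).map Prod.snd = c.rotate 1 := List.map_snd_zip (by simp)
  have h1 := sum_map_indicator_eq_one hc hv
  have h2 := sum_map_indicator_eq_one (List.nodup_rotate.2 hc) (List.mem_rotate (n := 1).2 hv)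
  rw [← hsnd, List.map_map] at h2
  nth_rewrite 1 [← hfst] at h1
  rw [List.map_map] at h1
  have hlen : ((cyclicPairs c).map fun _ => (1 : ℝ)).sum = c.length := by
    simp [cyclicPairs]
  unfold circuitDelay
  rw [List.map_congr_left hd, List.sum_map_add, List.sum_map_add, List.sum_map_add, hlen]
  simp only [Function.comp_def] at h1 h2
  rw [h1, h2]
  ring

theorem le_cycleTime {V : Type*} [Finite V] {A : V → V → Prop} (d : V → V → ℝ) {c : List V}
    (hc : IsElemCircuit A c) : circuitDelay d c / c.length ≤ cycleTime A d := by
  have := Fintype.ofFinite V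
  refine le_csSup (Set.Finite.bddAbove ?_) ⟨c, hc, rfl⟩
  refine ((List.finite_length_le V (Fintype.card V)).image
    fun c => circuitDelay d c / (c.length : ℝ)).subset ?_
  rintro _ ⟨γ, hγ, rfl⟩
  exact ⟨γ, hγ.2.1.length_le_card, rfl⟩

theorem length_eq_card_of_nodup_of_forall_mem {V : Type*} [Fintype V] {c : List V}
    (hc : c.Nodup) (hmem : ∀ v, v ∈ c) : c.length = Fintype.card V := by
  classical
  rw [← List.toFinset_card_of_nodup hc, ← Finset.card_univ]
  congr 1
  ext v
  simp [hmem v]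

/-- **NP-hardness reduction.** Given a connected undirected graph `D` on
`N ≥ 3` vertices, a distinguished vertex `v₀`, and the delay function of the reduction
(`1` on edges avoiding `v₀`; `2` on edges touching `v₀` and on non-edges avoiding `v₀`;
`3` on non-edges touching `v₀`), `D` has a Hamiltonian cycle iff the complete digraph
has a strongly connected spanning subdigraph of cycle time at most `(N+2)/N`. -/
theorem hamiltonian_iff_cycleTime_le {V : Type*} [Fintype V]
    (D : SimpleGraph V) (hD : D.Connected) (hN : 3 ≤ Fintype.card V)
    (v0 : V) (d : V → V → ℝ)
    (hd1 : ∀ i j : V, i ≠ j → D.Adj i j → i ≠ v0 → j ≠ v0 → d i j = 1)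
    (hd2 : ∀ i j : V, i ≠ j →
      ((D.Adj i j ∧ (i = v0 ∨ j = v0)) ∨ (¬ D.Adj i j ∧ i ≠ v0 ∧ j ≠ v0)) → d i j = 2)
    (hd3 : ∀ i j : V, i ≠ j → ¬ D.Adj i j → (i = v0 ∨ j = v0) → d i j = 3) :
    (∃ c : List V, c.Nodup ∧ (∀ v : V, v ∈ c) ∧ ∀ p ∈ cyclicPairs c, D.Adj p.1 p.2) ↔
    (∃ A : V → V → Prop, (∀ i j, A i j → i ≠ j) ∧ StronglyConnected A ∧
      cycleTime A d ≤ ((Fintype.card V : ℝ) + 2) / (Fintype.card V : ℝ)) := by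
  classical
  have hd : ∀ i j, i ≠ j → d i j = 1 + (if i = v0 then 1 else 0) + (if j = v0 then 1 else 0) +
      (if D.Adj i j then 0 else 1) := by
    intro i j hij
    by_cases hi : i = v0 <;> by_cases hj : j = v0 <;> by_cases hadj : D.Adj i j
    · exact absurd (hi.trans hj.symm) hij
    · exact absurd (hi.trans hj.symm) hij
    · rw [hd2 i j hij (by tauto)]; norm_num [hi, hj, hi ▸ hadj]
    · rw [hd3 i j hij hadj (by tauto)]; norm_num [hi, hj, hi ▸ hadj]
    · rw [hd2 i j hij (by tauto)]; norm_num [hi, hj, hj ▸ hadj]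
    · rw [hd3 i j hij hadj (by tauto)]; norm_num [hi, hj, hj ▸ hadj]
    · rw [hd1 i j hij hadj hi hj]; norm_num [hi, hj, hadj]
    · rw [hd2 i j hij (by tauto)]; norm_num [hi, hj, hadj]
  set h : V → V → ℝ := fun i j => if D.Adj i j then 0 else 1 with h_def
  have hNpos : (0 : ℝ) < Fintype.card V := by exact_mod_cast (by omega : 0 < Fintype.card V)
  constructor
  · rintro ⟨c, hnodup, hmem, hadj⟩
    refine ⟨fun i j => (i, j) ∈ cyclicPairs c, fun i j hij => (hadj _ hij).ne,
      stronglyConnected_cyclicPairs hmem, ?_⟩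
    refine Real.sSup_le ?_ (by positivity)
    rintro _ ⟨γ, hγ, rfl⟩
    have hγmem := hγ.mem_of_cyclicPairs hnodup hmem
    have hγadj : ∀ p ∈ cyclicPairs γ, D.Adj p.1 p.2 := fun p hp => hadj _ (hγ.2.2 p hp)
    have hzero : circuitDelay h γ = 0 := by
      refine List.sum_eq_zero fun x hx => ?_
      obtain ⟨p, hp, rfl⟩ := List.mem_map.1 hx
      exact if_pos (hγadj p hp)
    rw [circuitDelay_eq_length_add_two_add (h := h) hγ.2.1 (hγmem v0)
      (fun p hp => hd _ _ (hγadj p hp).ne), hzero,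
      length_eq_card_of_nodup_of_forall_mem hγ.2.1 hγmem, add_zero]
  · rintro ⟨A, hirrefl, hA, hτ⟩
    have : Nontrivial V := Fintype.one_lt_card_iff_nontrivial.1 (by omega)
    obtain ⟨c, hc, hv0⟩ := hA.exists_isElemCircuit_mem hirrefl v0
    have hle := (le_cycleTime d hc).trans hτ
    have hlen : c.length ≤ Fintype.card V := hc.2.1.length_le_card
    have hlenpos : (0 : ℝ) < c.length := by
      exact_mod_cast (by have := hc.1; omega : 0 < c.length)
    rw [circuitDelay_eq_length_add_two_add (h := h) hc.2.1 hv0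
      (fun p hp => hd _ _ (hirrefl _ _ (hc.2.2 p hp))), div_le_div_iff₀ hlenpos hNpos] at hle
    have hlen' : (c.length : ℝ) ≤ Fintype.card V := by exact_mod_cast hlen
    have hnonneg : ∀ x ∈ (cyclicPairs c).map fun p => h p.1 p.2, 0 ≤ x := by
      intro x hx
      obtain ⟨p, -, rfl⟩ := List.mem_map.1 hx
      simp only [h_def]
      split_ifs <;> norm_num
    have hsum : 0 ≤ circuitDelay h c := List.sum_nonneg hnonneg
    have hcard : c.length = Fintype.card V := by
      refine le_antisymm hlen ?_
      have : (Fintype.card V : ℝ) ≤ c.length := by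
        nlinarith [mul_nonneg hsum hNpos.le]
      exact_mod_cast this
    have hsum_le : circuitDelay h c ≤ 0 := by
      rw [hcard] at hle
      nlinarith
    refine ⟨c, hc.2.1, fun v => ?_, fun p hp => ?_⟩
    · have huniv : c.toFinset = Finset.univ :=
        Finset.eq_univ_of_card _ ((List.toFinset_card_of_nodup hc.2.1).trans hcard)
      exact List.mem_toFinset.1 (huniv ▸ Finset.mem_univ v)
    · by_contra hnot
      have hterm := (List.single_le_sum hnonneg (h p.1 p.2) (List.mem_map_of_mem hp)).trans hsum_le
      rw [h_def] at hterm
      simp only [if_neg hnot] at hterm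
      linarith
end

section
/- Let D = (V, E) be an undirected graph, fix a vertex v_0 ∈ V, and define a delay function d on ordered pairs of distinct vertices by: d(i,j) = 1 if {i,j} ∈ E and i ≠ v_0 and j ≠ v_0; d(i,j) = 2 if either ({i,j} ∈ E and (i = v_0 or j = v_0)) or ({i,j} ∉ E and i ≠ v_0 and j ≠ v_0); and d(i,j) = 3 if {i,j} ∉ E and (i = v_0 or j = v_0). Then d is symmetric (d(i,j) = d(j,i) for all distinct i, j) and satisfies the triangle inequality d(i,j) ≤ d(i,k) + d(k,j) for all pairwise distinct i, j, k; that is, d is Euclidean. -/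
/-- The delay function used in the NP-hardness reduction from
Hamiltonian Cycle (value `1` on edges avoiding `v₀`; `2` on edges touching `v₀` and on
non-edges avoiding `v₀`; `3` on non-edges touching `v₀`) is Euclidean: symmetric and
satisfying the triangle inequality on pairwise distinct triples. -/
theorem reduction_delay_is_euclidean {V : Type*}
    (D : SimpleGraph V) (v0 : V) (d : V → V → ℝ)
    (hd1 : ∀ i j : V, i ≠ j → D.Adj i j → i ≠ v0 → j ≠ v0 → d i j = 1)
    (hd2 : ∀ i j : V, i ≠ j →
      ((D.Adj i j ∧ (i = v0 ∨ j = v0)) ∨ (¬ D.Adj i j ∧ i ≠ v0 ∧ j ≠ v0)) → d i j = 2)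
    (hd3 : ∀ i j : V, i ≠ j → ¬ D.Adj i j → (i = v0 ∨ j = v0) → d i j = 3) :
    (∀ i j : V, i ≠ j → d i j = d j i) ∧
    (∀ i j k : V, i ≠ j → i ≠ k → j ≠ k → d i j ≤ d i k + d k j) := by
  classical
  have hd : ∀ i j : V, i ≠ j →
      d i j = (if D.Adj i j then 1 else 2) + (if i = v0 ∨ j = v0 then 1 else 0) := by
    intro i j hij
    by_cases hadj : D.Adj i j <;> by_cases hv : i = v0 ∨ j = v0
    · rw [hd2 i j hij (Or.inl ⟨hadj, hv⟩), if_pos hadj, if_pos hv]; norm_num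
    · rw [hd1 i j hij hadj (fun h => hv (Or.inl h)) (fun h => hv (Or.inr h)),
        if_pos hadj, if_neg hv]; norm_num
    · rw [hd3 i j hij hadj hv, if_neg hadj, if_pos hv]; norm_num
    · rw [hd2 i j hij (Or.inr ⟨hadj, not_or.mp hv⟩), if_neg hadj, if_neg hv]; norm_num
  refine ⟨fun i j hij => ?_, fun i j k hij hik hjk => ?_⟩
  · rw [hd i j hij, hd j i hij.symm]
    simp only [D.adj_comm i j, or_comm]
  · rw [hd i j hij, hd i k hik, hd k j hjk.symm]
    split_ifs <;> first | (norm_num; done) | tauto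
end

section
/- Let G = (V, E) be a connected undirected graph with N = |V| vertices and let k be a positive integer with k ≤ N. Build the undirected graph G_c with vertex set V × {1, 2}, with an edge {(v,1),(v,2)} for each v ∈ V and an edge {(u,1),(w,1)} for each {u,w} ∈ E, and node costs c((v,1)) = 1 and c((v,2)) = k+1. For a spanning tree T of G_c, define its cycle time as the maximum over edges {x,y} of T of (deg_T(x)·c(x) + deg_T(y)·c(y))/2, where deg_T denotes degree in T. Then G has a spanning tree in which every vertex has degree at most k if and only if G_c has a spanning tree with cycle time at most k+1. -/
namespace SimpleGraph

theorem Reachable.map_of_eq_or_adj {V W : Type*} {G : SimpleGraph V} {H : SimpleGraph W}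
    (f : V → W) (hf : ∀ x y, G.Adj x y → f x = f y ∨ H.Adj (f x) (f y)) {x y : V}
    (h : G.Reachable x y) : H.Reachable (f x) (f y) := by
  obtain ⟨p⟩ := h
  induction p with
  | nil => exact .refl _
  | cons hadj _ ih =>
    rcases hf _ _ hadj with heq | hadj'
    · rwa [heq]
    · exact hadj'.reachable.trans ih

/-- The graph obtained from `G` (on layer `false`) by attaching to each vertex `v` a pendant
vertex `(v, true)`. -/
def pendantGraph {V : Type*} (G : SimpleGraph V) : SimpleGraph (V × Bool) :=
  fromRel fun x y =>
    (x.1 = y.1 ∧ x.2 = false ∧ y.2 = true) ∨ (G.Adj x.1 y.1 ∧ x.2 = false ∧ y.2 = false)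

/-- The restriction of a graph on `V × Bool` to the layer `false`. -/
def baseLayer {V : Type*} (H : SimpleGraph (V × Bool)) : SimpleGraph V :=
  H.comap fun v => (v, false)

section PendantGraph

variable {V : Type*} {G : SimpleGraph V} {H : SimpleGraph (V × Bool)} {u v : V}

@[simp]
theorem baseLayer_adj : H.baseLayer.Adj u v ↔ H.Adj (u, false) (v, false) := Iff.rfl

@[simp]
theorem pendantGraph_adj_false_false :
    G.pendantGraph.Adj (u, false) (v, false) ↔ G.Adj u v := by
  simp only [pendantGraph, fromRel_adj]
  have := G.adj_comm u v
  have : G.Adj u v → u ≠ v := Adj.ne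
  grind

@[simp]
theorem pendantGraph_adj_false_true :
    G.pendantGraph.Adj (u, false) (v, true) ↔ u = v := by
  simp [pendantGraph]

@[simp]
theorem pendantGraph_adj_true_false :
    G.pendantGraph.Adj (u, true) (v, false) ↔ u = v := by
  rw [adj_comm, pendantGraph_adj_false_true, eq_comm]

@[simp]
theorem not_pendantGraph_adj_true_true : ¬ G.pendantGraph.Adj (u, true) (v, true) := by
  simp [pendantGraph]

@[simp]
theorem baseLayer_pendantGraph : G.pendantGraph.baseLayer = G := by
  ext; simp

theorem pendantGraph_mono {T : SimpleGraph V} (h : T ≤ G) : T.pendantGraph ≤ G.pendantGraph := by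
  rintro ⟨u, _ | _⟩ ⟨v, _ | _⟩ <;> simp
  exact @h u v

theorem baseLayer_le (h : H ≤ G.pendantGraph) : H.baseLayer ≤ G := fun _ _ hadj =>
  pendantGraph_adj_false_false.1 (h hadj)

theorem fst_eq_or_baseLayer_adj (h : H ≤ G.pendantGraph) (x y : V × Bool) (hadj : H.Adj x y) :
    x.1 = y.1 ∨ H.baseLayer.Adj x.1 y.1 := by
  have hG := h hadj
  rcases x with ⟨u, _ | _⟩ <;> rcases y with ⟨v, _ | _⟩ <;> simp_all

theorem isTree_baseLayer (h : H ≤ G.pendantGraph) (hH : H.IsTree) : H.baseLayer.IsTree where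
  preconnected u v :=
    (hH.connected.preconnected (u, false) (v, false)).map_of_eq_or_adj Prod.fst
      (fst_eq_or_baseLayer_adj h)
  nonempty := hH.connected.nonempty.map Prod.fst
  isAcyclic := hH.isAcyclic.of_comap ⟨fun v => (v, false), fun _ _ h => (Prod.ext_iff.1 h).1⟩

theorem connected_pendantGraph (hG : G.Connected) : G.pendantGraph.Connected := by
  obtain ⟨r⟩ := hG.nonempty
  have base (v : V) : G.pendantGraph.Reachable (r, false) (v, false) :=
    (hG.preconnected r v).map_of_eq_or_adj (fun v => (v, false)) fun u v h => by simp [h]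
  refine (connected_iff_exists_forall_reachable _).2 ⟨(r, false), ?_⟩
  rintro ⟨v, _ | _⟩
  · exact base v
  · exact (base v).trans (Adj.reachable (by simp))

theorem isBridge_pendantGraph_rung :
    G.pendantGraph.IsBridge s((v, true), (v, false)) := by
  rw [isBridge_iff]
  rintro ⟨p⟩
  cases p with
  | @cons _ y _ hadj _ =>
    rcases y with ⟨w, _ | _⟩ <;> simp [deleteEdges_adj] at hadj
    exact hadj.2 hadj.1.symm

theorem isAcyclic_pendantGraph (hG : G.IsAcyclic) : G.pendantGraph.IsAcyclic := by
  rw [isAcyclic_iff_forall_adj_isBridge]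
  rintro ⟨u, _ | _⟩ ⟨v, _ | _⟩ hadj
  · rw [pendantGraph_adj_false_false] at hadj
    have hb := isAcyclic_iff_forall_adj_isBridge.1 hG hadj
    rw [isBridge_iff] at hb ⊢
    refine fun h => hb (h.map_of_eq_or_adj Prod.fst ?_)
    rintro ⟨a, _ | _⟩ ⟨b, _ | _⟩ <;> simp [deleteEdges_adj] <;> grind
  · obtain rfl := pendantGraph_adj_false_true.1 hadj
    rw [Sym2.eq_swap]
    exact isBridge_pendantGraph_rung
  · obtain rfl := pendantGraph_adj_true_false.1 hadj
    exact isBridge_pendantGraph_rung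
  · exact absurd hadj not_pendantGraph_adj_true_true

theorem IsTree.pendantGraph (hG : G.IsTree) : G.pendantGraph.IsTree where
  connected := connected_pendantGraph hG.connected
  isAcyclic := isAcyclic_pendantGraph hG.isAcyclic

theorem adj_rung (h : H ≤ G.pendantGraph) (hH : H.Connected) (v : V) :
    H.Adj (v, false) (v, true) := by
  have : Nontrivial (V × Bool) := ⟨(v, false), (v, true), by simp⟩
  obtain ⟨⟨w, _ | _⟩, hadj⟩ := hH.preconnected.exists_adj_of_nontrivial (v, true)
  · obtain rfl := pendantGraph_adj_true_false.1 (h hadj)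
    exact hadj.symm
  · exact absurd (h hadj) not_pendantGraph_adj_true_true

theorem ncard_neighborSet_true (h : H ≤ G.pendantGraph) (hH : H.Connected) (v : V) :
    (H.neighborSet (v, true)).ncard = 1 := by
  refine Set.ncard_eq_one.2 ⟨(v, false), ?_⟩
  ext ⟨w, _ | _⟩
  · simp only [mem_neighborSet, Set.mem_singleton_iff, Prod.mk.injEq, and_true]
    refine ⟨fun hadj => (pendantGraph_adj_true_false.1 (h hadj)).symm, ?_⟩
    rintro rfl
    exact (adj_rung h hH w).symm
  · simpa using fun hadj => not_pendantGraph_adj_true_true (h hadj)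

theorem ncard_neighborSet_false [Finite V] (h : H ≤ G.pendantGraph) (hH : H.Connected) (v : V) :
    (H.neighborSet (v, false)).ncard = (H.baseLayer.neighborSet v).ncard + 1 := by
  have heq : H.neighborSet (v, false) =
      insert (v, true) ((fun w => (w, false)) '' H.baseLayer.neighborSet v) := by
    ext ⟨w, _ | _⟩
    · simp
    · simp only [mem_neighborSet, Set.mem_insert_iff, Prod.mk.injEq, and_true, Set.mem_image,
        Bool.false_eq_true, and_false, exists_false, or_false]
      refine ⟨fun hadj => (pendantGraph_adj_false_true.1 (h hadj)).symm, ?_⟩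
      rintro rfl
      exact adj_rung h hH w
  rw [heq, Set.ncard_insert_of_notMem (by simp),
    Set.ncard_image_of_injective _ fun _ _ h => (Prod.ext_iff.1 h).1]

theorem cycleTime_le_iff [Finite V] (h : H ≤ G.pendantGraph) (hH : H.Connected) (k : ℕ)
    (c : V × Bool → ℝ) (hc : ∀ x, c x = if x.2 then (k : ℝ) + 1 else 1) :
    sSup {z : ℝ | ∃ x y : V × Bool, H.Adj x y ∧
        z = (((H.neighborSet x).ncard : ℝ) * c x + ((H.neighborSet y).ncard : ℝ) * c y) / 2}
      ≤ (k : ℝ) + 1 ↔ ∀ v, (H.baseLayer.neighborSet v).ncard ≤ k := by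
  have hfalse (v : V) : ((H.neighborSet (v, false)).ncard : ℝ) * c (v, false) =
      (H.baseLayer.neighborSet v).ncard + 1 := by
    simp [hc, ncard_neighborSet_false h hH]
  have htrue (v : V) : ((H.neighborSet (v, true)).ncard : ℝ) * c (v, true) = k + 1 := by
    simp [hc, ncard_neighborSet_true h hH]
  constructor
  · intro hle v
    have hbdd : BddAbove {z : ℝ | ∃ x y : V × Bool, H.Adj x y ∧
        z = (((H.neighborSet x).ncard : ℝ) * c x + ((H.neighborSet y).ncard : ℝ) * c y) / 2} := by
      refine ((Set.finite_range fun p : (V × Bool) × (V × Bool) =>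
        (((H.neighborSet p.1).ncard : ℝ) * c p.1 +
          ((H.neighborSet p.2).ncard : ℝ) * c p.2) / 2).subset ?_).bddAbove
      rintro z ⟨x, y, -, rfl⟩
      exact ⟨(x, y), rfl⟩
    have hv := (le_csSup hbdd ⟨_, _, adj_rung h hH v, rfl⟩).trans hle
    rw [hfalse, htrue] at hv
    have : ((H.baseLayer.neighborSet v).ncard : ℝ) ≤ k := by linarith
    exact_mod_cast this
  · intro hdeg
    have hnode (x : V × Bool) : ((H.neighborSet x).ncard : ℝ) * c x ≤ k + 1 := by
      rcases x with ⟨v, _ | _⟩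
      · rw [hfalse]
        exact_mod_cast Nat.succ_le_succ (hdeg v)
      · exact (htrue v).le
    refine Real.sSup_le ?_ (by positivity)
    rintro z ⟨x, y, -, rfl⟩
    linarith [hnode x, hnode y]

end PendantGraph

end SimpleGraph

/-- **Prop. 4 reduction.** Degree-constrained spanning tree reduces to
minimal cycle time for undirected overlays on node-capacitated networks: `G` has a
spanning tree of maximum degree at most `k` iff the two-layer graph `G_c` (a rung
`{(v,1),(v,2)}` for each vertex `v` and an edge `{(u,1),(w,1)}` for each edge `{u,w}`
of `G`), with node costs `1` on layer 1 and `k+1` on layer 2, has a spanning tree of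
cycle time at most `k+1`, where the cycle time of a tree `T` is the maximum over its
edges `{x,y}` of `(deg_T(x)·c(x) + deg_T(y)·c(y))/2`. -/
theorem dcst_iff_cycleTime_le {V : Type*} [Fintype V] [DecidableEq V]
    (G : SimpleGraph V) (hG : G.Connected)
    (k : ℕ) (hk1 : 1 ≤ k) (hkN : k ≤ Fintype.card V)
    (Gc : SimpleGraph (V × Bool))
    (hGc : Gc = SimpleGraph.fromRel (fun x y =>
      (x.1 = y.1 ∧ x.2 = false ∧ y.2 = true) ∨ (G.Adj x.1 y.1 ∧ x.2 = false ∧ y.2 = false)))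
    (c : V × Bool → ℝ)
    (hc : ∀ x : V × Bool, c x = if x.2 then (k : ℝ) + 1 else 1) :
    (∃ T : SimpleGraph V, T ≤ G ∧ T.IsTree ∧ ∀ v : V, (T.neighborSet v).ncard ≤ k) ↔
    (∃ T : SimpleGraph (V × Bool), T ≤ Gc ∧ T.IsTree ∧
      sSup {z : ℝ | ∃ x y : V × Bool, T.Adj x y ∧
          z = (((T.neighborSet x).ncard : ℝ) * c x + ((T.neighborSet y).ncard : ℝ) * c y) / 2}
        ≤ (k : ℝ) + 1) := by
  change Gc = G.pendantGraph at hGc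
  subst hGc
  constructor
  · rintro ⟨T, hTG, hT, hdeg⟩
    refine ⟨T.pendantGraph, SimpleGraph.pendantGraph_mono hTG, hT.pendantGraph, ?_⟩
    rw [SimpleGraph.cycleTime_le_iff le_rfl hT.pendantGraph.connected k c hc]
    simpa using hdeg
  · rintro ⟨T, hTG, hT, hle⟩
    exact ⟨T.baseLayer, SimpleGraph.baseLayer_le hTG, SimpleGraph.isTree_baseLayer hTG hT,
      (SimpleGraph.cycleTime_le_iff hTG hT.connected k c hc).1 hle⟩
end

section
/- Let G = (V, E) be a finite connected undirected graph, in the node-capacitated setting with arc delays d_o^H(i,j) = s·T_c(i) + l(i,j) + deg_H(i)·a(i) and symmetrized weights w({i,j}) = [s·(T_c(i)+T_c(j)) + l(i,j) + l(j,i) + a(i) + a(j)]/2. If H is a spanning tree of G in which every vertex has degree at most 2 (a Hamiltonian path), then the cycle time of the bidirected overlay on H with delays d_o^H satisfies τ(H) ≤ 2·B(H), where B(H) = max_{{i,j} ∈ H} w({i,j}). -/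
theorem length_cyclicPairs {V : Type*} (c : List V) : (cyclicPairs c).length = c.length := by
  simp [cyclicPairs]

theorem sum_fst_cyclicPairs {V : Type*} (g : V → ℝ) (c : List V) :
    ((cyclicPairs c).map fun p => g p.1).sum = (c.map g).sum := by
  have h : (cyclicPairs c).map Prod.fst = c := List.map_fst_zip (by simp)
  conv_rhs => rw [← h, List.map_map]
  rfl

theorem sum_snd_cyclicPairs {V : Type*} (g : V → ℝ) (c : List V) :
    ((cyclicPairs c).map fun p => g p.2).sum = (c.map g).sum := by
  have h : (cyclicPairs c).map Prod.snd = c.rotate 1 := List.map_snd_zip (by simp)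
  rw [← ((c.rotate_perm 1).map g).sum_eq, ← h, List.map_map]
  rfl

/-- If every arc delay is at most `B` up to a potential difference, then so is the mean delay
of every circuit, since potential differences cancel around a circuit. -/
theorem circuitDelay_div_length_le {V : Type*} {A : V → V → Prop} {d : V → V → ℝ} {c : List V}
    (hc : IsElemCircuit A c) (g : V → ℝ) (B : ℝ) (h : ∀ i j, A i j → d i j ≤ B + (g i - g j)) :
    circuitDelay d c / (c.length : ℝ) ≤ B := by
  have hpos : (0 : ℝ) < c.length := by exact_mod_cast lt_of_lt_of_le two_pos hc.1
  rw [div_le_iff₀ hpos]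
  have hsum : ((cyclicPairs c).map fun p => d p.1 p.2 + g p.2).sum ≤
      ((cyclicPairs c).map fun p => B + g p.1).sum :=
    List.sum_le_sum fun p hp => by linarith [h _ _ (hc.2.2 p hp)]
  rw [List.sum_map_add, List.sum_map_add, sum_fst_cyclicPairs, sum_snd_cyclicPairs,
    add_le_add_iff_right] at hsum
  simpa [circuitDelay, length_cyclicPairs, mul_comm] using hsum

/-- In the node-capacitated setting, if `H` is a spanning tree of `G`
with maximum degree at most `2` (a Hamiltonian path), then the cycle time of the
bidirected overlay on `H` (with arc delays `s·T_c(i) + l(i,j) + deg_H(i)·a(i)`) is at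
most twice the bottleneck `B(H)` of `H` with respect to the symmetrized weights
`w({i,j}) = [s(T_c(i)+T_c(j)) + l(i,j) + l(j,i) + a(i) + a(j)]/2`. -/
theorem cycleTime_path_le_two_bottleneck {V : Type*} [Fintype V]
    (G : SimpleGraph V) (hG : G.Connected)
    (s : ℝ) (hs : 0 ≤ s)
    (Tc a : V → ℝ) (hTc : ∀ i, 0 ≤ Tc i) (ha : ∀ i, 0 ≤ a i)
    (l : V → V → ℝ) (hl : ∀ i j, 0 ≤ l i j)
    (H : SimpleGraph V) (hHG : H ≤ G) (hH : H.IsTree)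
    (hdeg : ∀ v : V, (H.neighborSet v).ncard ≤ 2) :
    cycleTime H.Adj
        (fun i j => s * Tc i + l i j + ((H.neighborSet i).ncard : ℝ) * a i) ≤
      2 * sSup {x : ℝ | ∃ i j : V, H.Adj i j ∧
        x = (s * (Tc i + Tc j) + l i j + l j i + a i + a j) / 2} := by
  set S := {x : ℝ | ∃ i j : V, H.Adj i j ∧
    x = (s * (Tc i + Tc j) + l i j + l j i + a i + a j) / 2}
  have hbdd : BddAbove S := by
    refine ((Set.finite_range fun p : V × V =>
      (s * (Tc p.1 + Tc p.2) + l p.1 p.2 + l p.2 p.1 + a p.1 + a p.2) / 2).subset ?_).bddAbove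
    rintro x ⟨i, j, -, rfl⟩
    exact ⟨(i, j), rfl⟩
  have hnonneg : 0 ≤ sSup S := by
    refine Real.sSup_nonneg ?_
    rintro x ⟨i, j, -, rfl⟩
    have := mul_nonneg hs (add_nonneg (hTc i) (hTc j))
    linarith [hl i j, hl j i, ha i, ha j]
  refine Real.sSup_le ?_ (by positivity)
  rintro x ⟨c, hc, rfl⟩
  refine circuitDelay_div_length_le hc a _ fun i j hij => ?_
  have hw := le_csSup hbdd (show _ ∈ S from ⟨i, j, hij, rfl⟩)
  have hd : ((H.neighborSet i).ncard : ℝ) * a i ≤ 2 * a i :=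
    mul_le_mul_of_nonneg_right (by exact_mod_cast hdeg i) (ha i)
  linarith [hl j i, mul_nonneg hs (hTc j)]
end

section
/- Let G = (V, E) be a finite connected undirected graph, in the node-capacitated setting with arc delays d_o^H(i,j) = s·T_c(i) + l(i,j) + deg_H(i)·a(i), symmetrized weights w({i,j}) = [s·(T_c(i)+T_c(j)) + l(i,j) + l(j,i) + a(i) + a(j)]/2, and bottleneck B(T) = max of w over the edges of T. If H is a spanning tree of G with maximum degree at most 2 (a Hamiltonian path) satisfying B(H) ≤ 3·min_{T' spanning tree of G} B(T'), then τ(H) ≤ 6·τ*, where τ(H) is the cycle time of the bidirected overlay on H with delays d_o^H and τ* is the minimum cycle time over all connected spanning subgraphs K of G of the bidirected overlay on K with delays d_o^K. -/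
theorem map_fst_cyclicPairs {V : Type*} (c : List V) : (cyclicPairs c).map Prod.fst = c := by
  simp [cyclicPairs, List.map_fst_zip]

theorem map_snd_cyclicPairs {V : Type*} (c : List V) :
    (cyclicPairs c).map Prod.snd = c.rotate 1 := by
  simp [cyclicPairs, List.map_snd_zip]

/-- A delay that is at most `b` on every arc up to a potential difference has total delay at most
`|γ| * b` on every circuit: the potential differences cancel around the circuit. -/
theorem circuitDelay_le_of_potential {V : Type*} {A : V → V → Prop} {d : V → V → ℝ} {b : ℝ}
    (f : V → ℝ) (h : ∀ i j, A i j → d i j ≤ b + f i - f j) {c : List V}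
    (hc : IsElemCircuit A c) : circuitDelay d c ≤ c.length * b := by
  have hsum : ((cyclicPairs c).map fun p => d p.1 p.2).sum ≤
      ((cyclicPairs c).map fun p => b + f p.1 - f p.2).sum :=
    List.sum_le_sum fun p hp => h _ _ (hc.2.2 p hp)
  have hfst : ((cyclicPairs c).map fun p => f p.1).sum = (c.map f).sum := by
    conv_rhs => rw [← map_fst_cyclicPairs c, List.map_map]
    rfl
  have hsnd : ((cyclicPairs c).map fun p => f p.2).sum = (c.map f).sum := by
    have hperm := ((c.rotate_perm 1).map f).sum_eq
    rw [← map_snd_cyclicPairs c, List.map_map] at hperm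
    exact hperm
  have hsplit : ∀ L : List (V × V), (L.map fun p => b + f p.1 - f p.2).sum =
      L.length * b + (L.map fun p => f p.1).sum - (L.map fun p => f p.2).sum := by
    intro L
    induction L with
    | nil => simp
    | cons p L ih =>
      simp only [List.map_cons, List.sum_cons, ih, List.length_cons]
      push_cast
      ring
  rw [hsplit, hfst, hsnd, length_cyclicPairs] at hsum
  unfold circuitDelay
  linarith

theorem cycleTime_le_of_potential {V : Type*} {A : V → V → Prop} {d : V → V → ℝ} {b : ℝ}
    (hb : 0 ≤ b) (f : V → ℝ) (h : ∀ i j, A i j → d i j ≤ b + f i - f j) :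
    cycleTime A d ≤ b := by
  refine Real.sSup_le ?_ hb
  rintro x ⟨c, hc, rfl⟩
  have hpos : (0 : ℝ) < c.length := by
    have := hc.1
    exact_mod_cast (by omega : 0 < c.length)
  rw [div_le_iff₀' hpos]
  exact circuitDelay_le_of_potential f h hc

theorem cycleTime_nonneg {V : Type*} {A : V → V → Prop} {d : V → V → ℝ}
    (hd : ∀ i j, 0 ≤ d i j) : 0 ≤ cycleTime A d := by
  refine Real.sSup_nonneg ?_
  rintro x ⟨c, -, rfl⟩
  refine div_nonneg (List.sum_nonneg ?_) (Nat.cast_nonneg _)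
  intro y hy
  obtain ⟨p, -, rfl⟩ := List.mem_map.1 hy
  exact hd _ _

/-- The mean delay of the two-arc circuit through an edge bounds the cycle time from below. -/
theorem two_cycle_le_cycleTime {V : Type*} [Finite V] {K : SimpleGraph V} (d : V → V → ℝ)
    {i j : V} (hij : K.Adj i j) : (d i j + d j i) / 2 ≤ cycleTime K.Adj d := by
  refine le_csSup (bddAbove_circuit_means _ _) ⟨[i, j], ⟨by simp, by simp [hij.ne], ?_⟩, ?_⟩
  · simp [cyclicPairs, hij, hij.symm]
  · simp [circuitDelay, cyclicPairs]

theorem one_le_ncard_neighborSet {V : Type*} [Finite V] {K : SimpleGraph V} {i j : V}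
    (hij : K.Adj i j) : (1 : ℝ) ≤ ((K.neighborSet i).ncard : ℝ) := by
  exact_mod_cast (Set.ncard_pos (Set.toFinite _)).2 ⟨j, hij⟩

theorem bddAbove_edge_values {V : Type*} [Finite V] (H : SimpleGraph V) (w : V → V → ℝ) :
    BddAbove {x : ℝ | ∃ i j : V, H.Adj i j ∧ x = w i j} := by
  refine ((Set.finite_range fun p : V × V => w p.1 p.2).subset ?_).bddAbove
  rintro x ⟨i, j, -, rfl⟩
  exact ⟨(i, j), rfl⟩

/-- **Prop. 5.** In the node-capacitated setting, if `H` is a spanning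
tree of `G` of maximum degree at most `2` (a Hamiltonian path) whose bottleneck is
within a factor `3` of the minimum spanning-tree bottleneck (the degree-2 MBST
approximation guarantee), then the cycle time of the bidirected overlay on `H` is at
most `6` times the minimum cycle time over all connected spanning subgraphs of `G`. -/
theorem six_approx_cycleTime {V : Type*} [Fintype V]
    (G : SimpleGraph V) (hG : G.Connected)
    (s : ℝ) (hs : 0 ≤ s)
    (Tc a : V → ℝ) (hTc : ∀ i, 0 ≤ Tc i) (ha : ∀ i, 0 ≤ a i)
    (l : V → V → ℝ) (hl : ∀ i j, 0 ≤ l i j)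
    (H : SimpleGraph V) (hHG : H ≤ G) (hH : H.IsTree)
    (hdeg : ∀ v : V, (H.neighborSet v).ncard ≤ 2)
    (hB : sSup {x : ℝ | ∃ i j : V, H.Adj i j ∧
            x = (s * (Tc i + Tc j) + l i j + l j i + a i + a j) / 2} ≤
          3 * sInf {b : ℝ | ∃ T : SimpleGraph V, T ≤ G ∧ T.IsTree ∧
            b = sSup {x : ℝ | ∃ i j : V, T.Adj i j ∧
              x = (s * (Tc i + Tc j) + l i j + l j i + a i + a j) / 2}}) :
    cycleTime H.Adj
        (fun i j => s * Tc i + l i j + ((H.neighborSet i).ncard : ℝ) * a i) ≤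
      6 * sInf {t : ℝ | ∃ K : SimpleGraph V, K ≤ G ∧ K.Connected ∧
        t = cycleTime K.Adj
          (fun i j => s * Tc i + l i j + ((K.neighborSet i).ncard : ℝ) * a i)} := by
  set w : V → V → ℝ := fun i j => (s * (Tc i + Tc j) + l i j + l j i + a i + a j) / 2 with hw
  have hw0 : ∀ i j, 0 ≤ w i j := by
    intro i j
    have := mul_nonneg hs (add_nonneg (hTc i) (hTc j))
    have := hl i j
    have := hl j i
    have := ha i
    have := ha j
    simp only [hw]
    linarith
  have hBnonneg : ∀ T : SimpleGraph V, 0 ≤ sSup {x : ℝ | ∃ i j : V, T.Adj i j ∧ x = w i j} := by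
    refine fun T => Real.sSup_nonneg ?_
    rintro x ⟨i, j, -, rfl⟩
    exact hw0 i j
  set B : ℝ := sSup {x : ℝ | ∃ i j : V, H.Adj i j ∧ x = w i j} with hBdef
  have hupper : cycleTime H.Adj
      (fun i j => s * Tc i + l i j + ((H.neighborSet i).ncard : ℝ) * a i) ≤ 2 * B := by
    refine cycleTime_le_of_potential (mul_nonneg zero_le_two (hBnonneg H)) a fun i j hij => ?_
    have hwB : w i j ≤ B := le_csSup (bddAbove_edge_values H w) ⟨i, j, hij, rfl⟩
    have hdeg2 : ((H.neighborSet i).ncard : ℝ) ≤ 2 := by exact_mod_cast hdeg i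
    have := mul_le_mul_of_nonneg_right hdeg2 (ha i)
    have := mul_nonneg hs (hTc j)
    have := hl j i
    simp only [hw] at hwB
    linarith
  suffices hlower : cycleTime H.Adj
      (fun i j => s * Tc i + l i j + ((H.neighborSet i).ncard : ℝ) * a i) / 6 ≤
      sInf {t : ℝ | ∃ K : SimpleGraph V, K ≤ G ∧ K.Connected ∧
        t = cycleTime K.Adj
          (fun i j => s * Tc i + l i j + ((K.neighborSet i).ncard : ℝ) * a i)} by
    linarith
  refine le_csInf ⟨_, G, le_rfl, hG, rfl⟩ ?_
  rintro t ⟨K, hKG, hK, rfl⟩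
  obtain ⟨T, hTK, hT⟩ := hK.exists_isTree_le
  have hinf : sInf {b : ℝ | ∃ T : SimpleGraph V, T ≤ G ∧ T.IsTree ∧
      b = sSup {x : ℝ | ∃ i j : V, T.Adj i j ∧ x = w i j}} ≤
      sSup {x : ℝ | ∃ i j : V, T.Adj i j ∧ x = w i j} := by
    refine csInf_le ⟨0, ?_⟩ ⟨T, hTK.trans hKG, hT, rfl⟩
    rintro b ⟨S, -, -, rfl⟩
    exact hBnonneg S
  have hTree : sSup {x : ℝ | ∃ i j : V, T.Adj i j ∧ x = w i j} ≤ cycleTime K.Adj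
      (fun i j => s * Tc i + l i j + ((K.neighborSet i).ncard : ℝ) * a i) := by
    refine Real.sSup_le ?_ (cycleTime_nonneg fun i j => add_nonneg
      (add_nonneg (mul_nonneg hs (hTc i)) (hl i j)) (mul_nonneg (Nat.cast_nonneg _) (ha i)))
    rintro x ⟨i, j, hij, rfl⟩
    refine le_trans ?_ (two_cycle_le_cycleTime _ (hTK hij))
    have := mul_le_mul_of_nonneg_right (one_le_ncard_neighborSet (hTK hij)) (ha i)
    have := mul_le_mul_of_nonneg_right (one_le_ncard_neighborSet (hTK hij).symm) (ha j)
    simp only [hw]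
    linarith
  linarith
end
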